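/- Under the gradient descent setup (f nonnegative C² with f(x₀) > 0; 4 f(x₀) < (1−ε)² r² α with α = α(x₀,r) and ε ∈ (0,1); L₁, L₂ bounds on first derivatives on B(x₀,r) and second derivatives on B(x₀,2r); η ≤ min{ r/(L₁√p), 2ε/(L₂ p) }; x_{j+1} := x_j − η∇f(x_j)), suppose k ≥ 1 and x₀, …, x_{k−1} ∈ B(x₀,r). Then (1−ε) α η ≤ 1, and for every 0 ≤ j ≤ k, f(x_j) ≤ (1 − (1−ε) α η)^j f(x₀). -/

import Mathlib

open Set Filter Metric

/-- Second-order Taylor upper bound on `[0, 1]` for a twice differentiable function whose second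
derivative is at most `C`. -/
theorem le_taylor_two_of_hasDerivAt {φ φ' φ'' : ℝ → ℝ} {C : ℝ}
    (h₁ : ∀ t, HasDerivAt φ (φ' t) t) (h₂ : ∀ t, HasDerivAt φ' (φ'' t) t)
    (hC : ∀ t ∈ Set.Icc (0 : ℝ) 1, φ'' t ≤ C) :
    φ 1 ≤ φ 0 + φ' 0 + C / 2 := by
  have hd₁ : ∀ t, HasDerivAt (fun t => φ' t - C * t) (φ'' t - C) t := fun t => by
    exact ((h₂ t).sub ((hasDerivAt_id t).const_mul C)).congr_deriv (by simp)
  have anti₁ : AntitoneOn (fun t => φ' t - C * t) (Set.Icc 0 1) := by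
    refine antitoneOn_of_deriv_nonpos (convex_Icc _ _)
      (fun t _ => (hd₁ t).continuousAt.continuousWithinAt)
      (fun t _ => (hd₁ t).differentiableAt.differentiableWithinAt) fun t ht => ?_
    rw [(hd₁ t).deriv]
    linarith [hC t (interior_subset ht)]
  have hd₀ : ∀ t, HasDerivAt (fun t => φ t - φ' 0 * t - C / 2 * t ^ 2)
      (φ' t - φ' 0 - C * t) t := fun t => by
    have h := ((h₁ t).sub ((hasDerivAt_id t).const_mul (φ' 0))).sub
      (((hasDerivAt_id t).pow 2).const_mul (C / 2))
    refine h.congr_deriv ?_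
    simp
    ring
  have anti₀ : AntitoneOn (fun t => φ t - φ' 0 * t - C / 2 * t ^ 2) (Set.Icc 0 1) := by
    refine antitoneOn_of_deriv_nonpos (convex_Icc _ _)
      (fun t _ => (hd₀ t).continuousAt.continuousWithinAt)
      (fun t _ => (hd₀ t).differentiableAt.differentiableWithinAt) fun t ht => ?_
    rw [(hd₀ t).deriv]
    have ht' := interior_subset ht
    have h := anti₁ (Set.left_mem_Icc.2 zero_le_one) ht' ht'.1
    simp only [mul_zero, sub_zero] at h
    linarith
  have h := anti₀ (Set.left_mem_Icc.2 zero_le_one) (Set.right_mem_Icc.2 zero_le_one) zero_le_one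
  simp only [mul_zero, sub_zero, mul_one, one_pow, ne_eq, OfNat.ofNat_ne_zero, not_false_eq_true,
    zero_pow] at h
  linarith

theorem ContinuousLinearMap.apply_eq_sum_euclideanSpace_single {p : ℕ}
    (A : EuclideanSpace ℝ (Fin p) →L[ℝ] ℝ) (v : EuclideanSpace ℝ (Fin p)) :
    A v = ∑ i, v i * A (EuclideanSpace.single i 1) := by
  conv_lhs => rw [← (EuclideanSpace.basisFun (Fin p) ℝ).sum_repr v]
  simp

theorem EuclideanSpace.sq_sum_abs_le {p : ℕ} (v : EuclideanSpace ℝ (Fin p)) :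
    (∑ i, |v i|) ^ 2 ≤ p * ‖v‖ ^ 2 := by
  have h := sq_sum_le_card_mul_sum_sq (s := Finset.univ) (f := fun i => |v i|)
  simpa [EuclideanSpace.real_norm_sq_eq] using h

/-- The descent inequality for a `C²` function whose second-order partial derivatives are bounded
by `L` along the segment from `u` to `u + v`. -/
theorem ContDiff.le_add_fderiv_add_of_abs_partial_le {p : ℕ} {f : EuclideanSpace ℝ (Fin p) → ℝ}
    (hf : ContDiff ℝ 2 f) {u v : EuclideanSpace ℝ (Fin p)} {L : ℝ} (hL0 : 0 ≤ L)
    (hL : ∀ t ∈ Set.Icc (0 : ℝ) 1, ∀ i j : Fin p,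
      |fderiv ℝ (fun w => fderiv ℝ f w (EuclideanSpace.single i 1)) (u + t • v)
        (EuclideanSpace.single j 1)| ≤ L) :
    f (u + v) ≤ f u + fderiv ℝ f u v + L * p * ‖v‖ ^ 2 / 2 := by
  set g : Fin p → EuclideanSpace ℝ (Fin p) → ℝ :=
    fun i w => fderiv ℝ f w (EuclideanSpace.single i 1) with hg
  have hf1 : Differentiable ℝ f := hf.differentiable (by norm_num)
  have hf2 : Differentiable ℝ (fderiv ℝ f) :=
    (hf.fderiv_right (m := 1) (by norm_num)).differentiable (by norm_num)
  have hgd : ∀ i, Differentiable ℝ (g i) := fun i => hf2.clm_apply (differentiable_const _)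
  have hline : ∀ t : ℝ, HasDerivAt (fun t : ℝ => u + t • v) v t := fun t => by
    simpa using ((hasDerivAt_id t).smul_const v).const_add u
  have h₁ : ∀ t : ℝ, HasDerivAt (fun t : ℝ => f (u + t • v))
      (∑ i, v i * g i (u + t • v)) t := fun t => by
    rw [← ContinuousLinearMap.apply_eq_sum_euclideanSpace_single]
    exact (hf1 _).hasFDerivAt.comp_hasDerivAt t (hline t)
  have h₂ : ∀ t : ℝ, HasDerivAt (fun t : ℝ => ∑ i, v i * g i (u + t • v))
      (∑ i, v i * fderiv ℝ (g i) (u + t • v) v) t := fun t =>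
    HasDerivAt.fun_sum fun i _ =>
      (((hgd i) _).hasFDerivAt.comp_hasDerivAt t (hline t)).const_mul (v i)
  have hC : ∀ t ∈ Set.Icc (0 : ℝ) 1,
      ∑ i, v i * fderiv ℝ (g i) (u + t • v) v ≤ L * p * ‖v‖ ^ 2 := fun t ht => by
    calc ∑ i, v i * fderiv ℝ (g i) (u + t • v) v
        ≤ ∑ i, |v i| * ∑ j, |v j| * L := by
          refine Finset.sum_le_sum fun i _ => (le_abs_self _).trans ?_
          rw [abs_mul]
          refine mul_le_mul_of_nonneg_left ?_ (abs_nonneg _)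
          rw [ContinuousLinearMap.apply_eq_sum_euclideanSpace_single]
          refine (Finset.abs_sum_le_sum_abs _ _).trans (Finset.sum_le_sum fun j _ => ?_)
          rw [abs_mul]
          exact mul_le_mul_of_nonneg_left (hL t ht i j) (abs_nonneg _)
      _ = L * (∑ i, |v i|) ^ 2 := by
          rw [← Finset.sum_mul, ← Finset.sum_mul]
          ring
      _ ≤ L * (p * ‖v‖ ^ 2) := mul_le_mul_of_nonneg_left (EuclideanSpace.sq_sum_abs_le v) hL0
      _ = L * p * ‖v‖ ^ 2 := by ring
  have h := le_taylor_two_of_hasDerivAt h₁ h₂ hC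
  rw [ContinuousLinearMap.apply_eq_sum_euclideanSpace_single (fderiv ℝ f u) v]
  simpa using h

theorem norm_gradient_le_of_abs_partial_le {p : ℕ} {f : EuclideanSpace ℝ (Fin p) → ℝ}
    {z : EuclideanSpace ℝ (Fin p)} {L : ℝ} (hL0 : 0 ≤ L)
    (hL : ∀ i : Fin p, |fderiv ℝ f z (EuclideanSpace.single i 1)| ≤ L) :
    ‖gradient f z‖ ≤ L * Real.sqrt p := by
  have hcoord : ∀ i, gradient f z i = fderiv ℝ f z (EuclideanSpace.single i 1) := fun i => by
    have h : inner ℝ (gradient f z) (EuclideanSpace.single i 1) =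
        fderiv ℝ f z (EuclideanSpace.single i 1) := by
      simp [gradient]
    rw [← h, EuclideanSpace.inner_single_right]
    simp
  refine abs_le_of_sq_le_sq' ?_ (by positivity) |>.2
  rw [EuclideanSpace.real_norm_sq_eq, mul_pow, Real.sq_sqrt (Nat.cast_nonneg p)]
  calc ∑ i, gradient f z i ^ 2 ≤ ∑ _i : Fin p, L ^ 2 := by
        refine Finset.sum_le_sum fun i _ => ?_
        rw [hcoord, ← sq_abs]
        exact pow_le_pow_left₀ (abs_nonneg _) (hL i) 2
    _ = L ^ 2 * p := by simp [mul_comm]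

/-- **Lemma 4.3.** In the gradient descent setup, if `x₀, …, x_{k−1} ∈ B(x₀,r)`, then
`(1−ε)αη ≤ 1` and `f(x_j) ≤ (1 − (1−ε)αη)^j f(x₀)` for every `0 ≤ j ≤ k`. -/
theorem gd_loss_geometric_decay
    {p : ℕ} (hp : 0 < p)
    (f : EuclideanSpace ℝ (Fin p) → ℝ)
    (hf : ContDiff ℝ 2 f) (hf0 : ∀ x, 0 ≤ f x)
    (x₀ : EuclideanSpace ℝ (Fin p)) (r : ℝ) (hr : 0 < r)
    (hfx₀ : 0 < f x₀)
    (α : ℝ)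
    (hα : ∀ x ∈ Metric.closedBall x₀ r, f x ≠ 0 → α * f x ≤ ‖gradient f x‖ ^ 2)
    (ε : ℝ) (hε : ε ∈ Set.Ioo (0:ℝ) 1)
    (hmainε : 4 * f x₀ < (1 - ε) ^ 2 * r ^ 2 * α)
    (L₁ L₂ : ℝ)
    (hL₁ : ∀ z ∈ Metric.closedBall x₀ r, ∀ i : Fin p,
      |fderiv ℝ f z (EuclideanSpace.single i 1)| ≤ L₁)
    (hL₂ : ∀ z ∈ Metric.closedBall x₀ (2 * r), ∀ i j : Fin p,
      |fderiv ℝ (fun v => fderiv ℝ f v (EuclideanSpace.single i 1)) z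
        (EuclideanSpace.single j 1)| ≤ L₂)
    (η : ℝ) (hη : 0 < η)
    (hηle : η ≤ min (r / (L₁ * Real.sqrt p)) (2 * ε / (L₂ * p)))
    (x : ℕ → EuclideanSpace ℝ (Fin p)) (hx0 : x 0 = x₀)
    (hxrec : ∀ j : ℕ, x (j + 1) = x j - η • gradient f (x j))
    (k : ℕ) (hk : 1 ≤ k)
    (hball : ∀ j < k, x j ∈ Metric.closedBall x₀ r) :
    (1 - ε) * α * η ≤ 1 ∧
    ∀ j ≤ k, f (x j) ≤ (1 - (1 - ε) * α * η) ^ j * f x₀ := by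
  obtain ⟨hε0, hε1⟩ := hε
  have hpR : (0 : ℝ) < p := Nat.cast_pos.2 hp
  have hη1 : η ≤ r / (L₁ * Real.sqrt p) := hηle.trans (min_le_left _ _)
  have hη2 : η ≤ 2 * ε / (L₂ * p) := hηle.trans (min_le_right _ _)
  have hd1 : 0 < L₁ * Real.sqrt p := (div_pos_iff_of_pos_left hr).1 (hη.trans_le hη1)
  have hd2 : 0 < L₂ * p := (div_pos_iff_of_pos_left (by positivity)).1 (hη.trans_le hη2)
  have hL₁0 : 0 < L₁ := pos_of_mul_pos_left hd1 (Real.sqrt_nonneg _)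
  have hL₂0 : 0 < L₂ := pos_of_mul_pos_left hd2 hpR.le
  rw [le_div_iff₀ hd1] at hη1
  rw [le_div_iff₀ hd2] at hη2
  have step : ∀ y ∈ Metric.closedBall x₀ r,
      f (y - η • gradient f y) ≤ (1 - (1 - ε) * α * η) * f y := fun y hy => by
    have hgrad : ‖η • gradient f y‖ ≤ r := by
      rw [norm_smul, Real.norm_of_nonneg hη.le]
      exact (mul_le_mul_of_nonneg_left
        (norm_gradient_le_of_abs_partial_le hL₁0.le (hL₁ y hy)) hη.le).trans hη1
    have hseg : ∀ t ∈ Set.Icc (0 : ℝ) 1,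
        y + t • (-(η • gradient f y)) ∈ Metric.closedBall x₀ (2 * r) := fun t ht => by
      rw [mem_closedBall_iff_norm] at hy ⊢
      calc ‖y + t • (-(η • gradient f y)) - x₀‖
          = ‖(y - x₀) + t • (-(η • gradient f y))‖ := by congr 1; abel
        _ ≤ ‖y - x₀‖ + ‖t • (-(η • gradient f y))‖ := norm_add_le _ _
        _ ≤ r + 1 * r := by
            rw [norm_smul, norm_neg, Real.norm_of_nonneg ht.1]
            exact add_le_add hy (mul_le_mul ht.2 hgrad (norm_nonneg _) zero_le_one)
        _ = 2 * r := by ring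
    have hdesc := hf.le_add_fderiv_add_of_abs_partial_le hL₂0.le fun t ht => hL₂ _ (hseg t ht)
    have hfd : fderiv ℝ f y (-(η • gradient f y)) = -(η * ‖gradient f y‖ ^ 2) := by
      have h : inner ℝ (gradient f y) (gradient f y) = fderiv ℝ f y (gradient f y) := by
        rw [gradient, InnerProductSpace.toDual_symm_apply]
      rw [map_neg, map_smul, ← h, real_inner_self_eq_norm_sq, smul_eq_mul]
    rw [hfd, norm_neg, norm_smul, Real.norm_of_nonneg hη.le, ← sub_eq_add_neg] at hdesc
    have hαf : α * f y ≤ ‖gradient f y‖ ^ 2 := by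
      by_cases h0 : f y = 0
      · simp [h0]
      · exact hα y hy h0
    have hquad := mul_le_mul_of_nonneg_left hη2 (by positivity : 0 ≤ η * ‖gradient f y‖ ^ 2)
    have hgain := mul_le_mul_of_nonneg_left hαf (mul_nonneg (sub_nonneg.2 hε1.le) hη.le)
    linarith
  have hrate : (1 - ε) * α * η ≤ 1 := by
    have h := (hf0 _).trans (step x₀ (Metric.mem_closedBall_self hr.le))
    linarith [nonneg_of_mul_nonneg_left h hfx₀]
  refine ⟨hrate, fun j => ?_⟩
  induction j with
  | zero => simp [hx0]
  | succ j ih =>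
    intro hj
    rw [hxrec, pow_succ', mul_assoc]
    exact (step _ (hball j hj)).trans
      (mul_le_mul_of_nonneg_left (ih (Nat.le_of_succ_le hj)) (sub_nonneg.2 hrate))
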